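/- arXiv:2102.11800 — 7 statements merged into one kernel-verified Lean document; each statement's English description precedes it below -/
import Mathlib

section
/- Let p ≥ 1, let λ denote Lebesgue measure on ℝ^p, and let C_γ ∈ (0, 1/2). Let R = ∏_{ℓ=1}^p (a_ℓ, b_ℓ] be an axis-aligned box with 0 ≤ a_ℓ < b_ℓ ≤ 1 for every ℓ. Let S ⊆ {1,…,p} be nonempty and let k ∈ S. Assume a_ℓ = 0 for every ℓ ∈ S, and additionally a_k = 0 and b_k = 1. Let γ_ℓ ∈ [C_γ, 1−C_γ] for every ℓ ∈ S∖{k}. Then λ( R ∩ {x ∈ ℝ^p : x_ℓ ≤ γ_ℓ for all ℓ ∈ S∖{k}} ) ≥ C_γ^{|S|−1} · λ(R). -/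
open MeasureTheory

/-- **Lemma 4 (sufficient overlap).** For an axis-aligned box `R = ∏ (a_ℓ, b_ℓ] ⊆ [0,1]^p`
whose lower bounds vanish on the interaction features `S` and which is unconstrained in the
coordinate `k ∈ S` (`a_k = 0`, `b_k = 1`), the volume of the part of `R` where all remaining
interaction coordinates `ℓ ∈ S \ {k}` lie below their thresholds `γ_ℓ ∈ [C_γ, 1−C_γ]`
is at least `C_γ^{|S|−1} · λ(R)`. -/
theorem sufficient_overlap (p : ℕ) (hp : 1 ≤ p)
    (C_γ : ℝ) (hCγ : C_γ ∈ Set.Ioo (0 : ℝ) (1 / 2))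
    (a b : Fin p → ℝ) (hab : ∀ ℓ, 0 ≤ a ℓ ∧ a ℓ < b ℓ ∧ b ℓ ≤ 1)
    (S : Finset (Fin p)) (hS : S.Nonempty) (k : Fin p) (hk : k ∈ S)
    (haS : ∀ ℓ ∈ S, a ℓ = 0) (hak : a k = 0) (hbk : b k = 1)
    (γ : Fin p → ℝ) (hγ : ∀ ℓ ∈ S.erase k, γ ℓ ∈ Set.Icc C_γ (1 - C_γ)) :
    ENNReal.ofReal (C_γ ^ (S.card - 1)) *
        volume (Set.univ.pi fun ℓ => Set.Ioc (a ℓ) (b ℓ))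
      ≤ volume ((Set.univ.pi fun ℓ => Set.Ioc (a ℓ) (b ℓ)) ∩
          {x : Fin p → ℝ | ∀ ℓ ∈ S.erase k, x ℓ ≤ γ ℓ}) := by
  obtain ⟨hC0, hC1⟩ := hCγ
  have hset : ((Set.univ.pi fun ℓ => Set.Ioc (a ℓ) (b ℓ)) ∩
          {x : Fin p → ℝ | ∀ ℓ ∈ S.erase k, x ℓ ≤ γ ℓ}) =
      Set.univ.pi fun ℓ => Set.Ioc (a ℓ)
        ((fun ℓ => if ℓ ∈ S.erase k then min (b ℓ) (γ ℓ) else b ℓ) ℓ) := by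
    ext x
    simp only [Set.mem_inter_iff, Set.mem_univ_pi, Set.mem_Ioc, Set.mem_setOf_eq]
    constructor
    · rintro ⟨h1, h2⟩ ℓ
      refine ⟨(h1 ℓ).1, ?_⟩
      split_ifs with h
      · exact le_min (h1 ℓ).2 (h2 ℓ h)
      · exact (h1 ℓ).2
    · intro h
      refine ⟨fun ℓ => ⟨(h ℓ).1, ?_⟩, fun ℓ hl => ?_⟩
      · have := (h ℓ).2
        split_ifs at this with h'
        · exact this.trans (min_le_left _ _)
        · exact this
      · have := (h ℓ).2
        rw [if_pos hl] at this
        exact this.trans (min_le_right _ _)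
  have hpow : ENNReal.ofReal (C_γ ^ (S.card - 1)) =
      ∏ ℓ : Fin p, (if ℓ ∈ S.erase k then ENNReal.ofReal C_γ else 1) := by
    rw [Finset.prod_ite_mem, Finset.univ_inter, Finset.prod_const,
      Finset.card_erase_of_mem hk, ENNReal.ofReal_pow hC0.le]
  rw [hset, Real.volume_pi_Ioc, Real.volume_pi_Ioc, hpow, ← Finset.prod_mul_distrib]
  refine Finset.prod_le_prod' fun ℓ _ => ?_
  by_cases h : ℓ ∈ S.erase k
  · simp only [if_pos h]
    rw [← ENNReal.ofReal_mul hC0.le, haS ℓ (Finset.mem_of_mem_erase h)]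
    apply ENNReal.ofReal_le_ofReal
    obtain ⟨h1, h2, h3⟩ := hab ℓ
    have h4 := (hγ ℓ h).1
    rw [sub_zero, sub_zero]
    apply le_min <;> nlinarith
  · simp only [if_neg h, one_mul, le_refl]
end

section
/- Let p ≥ 1, λ Lebesgue measure on ℝ^p, and let S_1,…,S_J ⊆ {1,…,p} be pairwise disjoint nonempty sets. Let γ_ℓ ∈ (0,1) for each ℓ ∈ ∪_j S_j, let β_0, β_1,…,β_J ∈ ℝ, and define f(x) = β_0 + Σ_{j=1}^J β_j·∏_{ℓ∈S_j} 1(x_ℓ ≤ γ_ℓ). Let R = ∏_{ℓ=1}^p (a_ℓ, b_ℓ] be a box with 0 ≤ a_ℓ < b_ℓ ≤ 1 and λ(R) > 0. Fix j ∈ {1,…,J} and k ∈ S_j, and assume a_k = 0 and b_k = 1. For γ ∈ (0,1) set R_l = R ∩ {x : x_k ≤ γ} and R_r = R ∩ {x : x_k > γ}, and define the population impurity decrease Δ_I(R_l, R_r) = (λ(R_l)·λ(R_r)/λ(R)) · (m_l − m_r)², where m_l = λ(R_l)⁻¹·∫_{R_l} f dλ and m_r = λ(R_r)⁻¹·∫_{R_r}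 f dλ. Then Δ_I(R_l, R_r) = λ(R) · β_j² · q² · [ 1(γ ≤ γ_k)·(1−γ_k)²·γ/(1−γ) + 1(γ > γ_k)·γ_k²·(1−γ)/γ ], where q = λ( R ∩ {x : x_ℓ ≤ γ_ℓ for all ℓ ∈ S_j∖{k}} ) / λ(R). -/
open MeasureTheory

noncomputable def Wfac {p : ℕ} (a b g : Fin p → ℝ) (k : Fin p) (T : Finset (Fin p)) : ℝ :=
  ∏ l ∈ Finset.univ.erase k,
    (volume (Set.Ioc (a l) (b l) ∩ (if l ∈ T then Set.Iic (g l) else Set.univ))).toReal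

theorem vol_slab {p : ℕ} (a b g : Fin p → ℝ) (k : Fin p) (T : Finset (Fin p)) (s : Set ℝ)
    (hs : s ⊆ Set.Ioc (a k) (b k)) :
    (volume (((Set.univ.pi fun l => Set.Ioc (a l) (b l)) ∩ {x | x k ∈ s}) ∩
      {x : Fin p → ℝ | ∀ l ∈ T, x l ≤ g l})).toReal
      = (volume (s ∩ (if k ∈ T then Set.Iic (g k) else Set.univ))).toReal * Wfac a b g k T := by
  have h : (((Set.univ.pi fun l => Set.Ioc (a l) (b l)) ∩ {x | x k ∈ s}) ∩
      {x : Fin p → ℝ | ∀ l ∈ T, x l ≤ g l}) =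
      Set.univ.pi fun l => (if l = k then s else Set.Ioc (a l) (b l)) ∩
        (if l ∈ T then Set.Iic (g l) else Set.univ) := by
    ext x
    simp only [Set.mem_inter_iff, Set.mem_pi, Set.mem_univ, true_implies, Set.mem_setOf_eq]
    constructor
    · rintro ⟨⟨h1, h2⟩, h3⟩ l
      refine ⟨?_, ?_⟩
      · split_ifs with hl
        · subst hl; exact h2
        · exact h1 l
      · split_ifs with hl
        · exact h3 l hl
        · trivial
    · intro h
      have hk : x k ∈ s := by simpa using (h k).1
      refine ⟨⟨fun l => ?_, hk⟩, fun l hl => ?_⟩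
      · by_cases hl : l = k
        · subst hl; exact hs hk
        · simpa [hl] using (h l).1
      · simpa [hl] using (h l).2
  rw [h, volume_pi_pi, ENNReal.toReal_prod, ← Finset.mul_prod_erase _ _ (Finset.mem_univ k)]
  unfold Wfac
  congr 1
  · simp
  · apply Finset.prod_congr rfl
    intro l hl
    rw [if_neg (Finset.ne_of_mem_erase hl)]

theorem int_slab {p J : ℕ} (S : Fin J → Finset (Fin p)) (g : Fin p → ℝ) (β0 : ℝ) (β : Fin J → ℝ)
    (A : Set (Fin p → ℝ)) (hAf : volume A ≠ ⊤) :
    ∫ x in A, (β0 + ∑ j', β j' * ∏ l ∈ S j', (if x l ≤ g l then (1 : ℝ) else 0))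
      = β0 * (volume A).toReal + ∑ j', β j' *
        (volume (A ∩ {x : Fin p → ℝ | ∀ l ∈ S j', x l ≤ g l})).toReal := by
  haveI : IsFiniteMeasure (volume.restrict A) := ⟨by simpa using hAf.lt_top⟩
  have hm : ∀ T : Finset (Fin p), MeasurableSet {x : Fin p → ℝ | ∀ l ∈ T, x l ≤ g l} := by
    intro T
    have : {x : Fin p → ℝ | ∀ l ∈ T, x l ≤ g l} = ⋂ l ∈ T, {x | x l ≤ g l} := by
      ext x; simp
    rw [this]
    exact Finset.measurableSet_biInter _ fun l _ =>
      measurableSet_le (measurable_pi_apply l) measurable_const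
  have he : ∀ (x : Fin p → ℝ) (T : Finset (Fin p)), (∏ l ∈ T, (if x l ≤ g l then (1 : ℝ) else 0))
      = Set.indicator {x : Fin p → ℝ | ∀ l ∈ T, x l ≤ g l} (fun _ => (1 : ℝ)) x := by
    intro x T
    rw [Finset.prod_ite_zero]
    simp [Set.indicator_apply]
  simp_rw [he]
  have hi : ∀ T : Finset (Fin p), Integrable (fun x =>
      Set.indicator {x : Fin p → ℝ | ∀ l ∈ T, x l ≤ g l} (fun _ => (1 : ℝ)) x)
      (volume.restrict A) := fun T => (integrable_const 1).indicator (hm T)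
  rw [integral_add (integrable_const _)
    (integrable_finsetSum _ fun i _ => (hi (S i)).const_mul _),
    integral_finsetSum _ fun i _ => (hi (S i)).const_mul _]
  congr 1
  · simp [Measure.real, mul_comm]
  · apply Finset.sum_congr rfl
    intro i _
    rw [integral_const_mul, integral_indicator (hm _)]
    simp [Measure.real, Measure.restrict_apply (hm _), Set.inter_comm]

/-- **Lemma 3 of the paper (impurity decrease formula).** Under the LSS model
`f(x) = β₀ + Σ_j β_j · ∏_{ℓ∈S_j} 1(x_ℓ ≤ γ_ℓ)` with pairwise disjoint basic interactions,
splitting a box `R` (unconstrained in the signal coordinate `k ∈ S_j`) on coordinate `k`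
at threshold `γ ∈ (0,1)` gives population impurity decrease
`λ(R)·β_j²·q²·[1(γ ≤ γ_k)(1−γ_k)²γ/(1−γ) + 1(γ > γ_k)γ_k²(1−γ)/γ]`. -/
theorem impurity_decrease_signal_split (p J : ℕ) (hp : 1 ≤ p)
    (S : Fin J → Finset (Fin p)) (hSne : ∀ j, (S j).Nonempty)
    (hdisj : ∀ j₁ j₂, j₁ ≠ j₂ → Disjoint (S j₁) (S j₂))
    (γthr : Fin p → ℝ) (hγthr : ∀ j, ∀ ℓ ∈ S j, γthr ℓ ∈ Set.Ioo (0 : ℝ) 1)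
    (β0 : ℝ) (β : Fin J → ℝ)
    (a b : Fin p → ℝ) (hab : ∀ ℓ, 0 ≤ a ℓ ∧ a ℓ < b ℓ ∧ b ℓ ≤ 1)
    (hRpos : 0 < volume (Set.univ.pi fun ℓ => Set.Ioc (a ℓ) (b ℓ)))
    (j : Fin J) (k : Fin p) (hk : k ∈ S j) (hak : a k = 0) (hbk : b k = 1)
    (γ : ℝ) (hγ : γ ∈ Set.Ioo (0 : ℝ) 1) :
    let f : (Fin p → ℝ) → ℝ := fun x =>
      β0 + ∑ j', β j' * ∏ ℓ ∈ S j', (if x ℓ ≤ γthr ℓ then (1 : ℝ) else 0)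
    let R : Set (Fin p → ℝ) := Set.univ.pi fun ℓ => Set.Ioc (a ℓ) (b ℓ)
    let Rl : Set (Fin p → ℝ) := R ∩ {x | x k ≤ γ}
    let Rr : Set (Fin p → ℝ) := R ∩ {x | γ < x k}
    let ml : ℝ := ((volume Rl).toReal)⁻¹ * ∫ x in Rl, f x
    let mr : ℝ := ((volume Rr).toReal)⁻¹ * ∫ x in Rr, f x
    let q : ℝ := (volume (R ∩ {x : Fin p → ℝ | ∀ ℓ ∈ (S j).erase k, x ℓ ≤ γthr ℓ})).toReal
                  / (volume R).toReal
    ((volume Rl).toReal * (volume Rr).toReal / (volume R).toReal) * (ml - mr) ^ 2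
      = (volume R).toReal * (β j) ^ 2 * q ^ 2 *
          (if γ ≤ γthr k then (1 - γthr k) ^ 2 * γ / (1 - γ)
           else (γthr k) ^ 2 * (1 - γ) / γ) := by
  intro f R Rl Rr ml mr q
  obtain ⟨hγ0, hγ1⟩ := hγ
  obtain ⟨hg0, hg1⟩ := hγthr j k hk
  set W := Wfac a b γthr k with hW
  have hv := fun T s hs => vol_slab a b γthr k T s hs
  have hR : ∀ s, s ⊆ Set.Ioc (a k) (b k) → (volume (R ∩ {x | x k ∈ s})).toReal
      = (volume s).toReal * W ∅ := by
    intro s hs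
    simpa using hv ∅ s hs
  have eR : R ∩ {x | x k ∈ Set.Ioc (0:ℝ) 1} = R := by
    apply Set.inter_eq_left.2
    intro x hx
    have : x k ∈ Set.Ioc (a k) (b k) := hx k trivial
    rwa [hak, hbk] at this
  have eRl : R ∩ {x | x k ∈ Set.Ioc (0:ℝ) γ} = Rl := by
    ext x
    simp only [Rl, Set.mem_inter_iff, Set.mem_setOf_eq, Set.mem_Ioc]
    refine and_congr_right fun hx => ⟨fun h => h.2, fun h => ⟨?_, h⟩⟩
    have := (hx k trivial).1
    rwa [hak] at this
  have eRr : R ∩ {x | x k ∈ Set.Ioc γ 1} = Rr := by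
    ext x
    simp only [Rr, Set.mem_inter_iff, Set.mem_setOf_eq, Set.mem_Ioc]
    refine and_congr_right fun hx => ⟨fun h => h.1, fun h => ⟨h, ?_⟩⟩
    have := (hx k trivial).2
    rwa [hbk] at this
  have s1 : Set.Ioc (0:ℝ) 1 ⊆ Set.Ioc (a k) (b k) := by rw [hak, hbk]
  have s2 : Set.Ioc (0:ℝ) γ ⊆ Set.Ioc (a k) (b k) :=
    (Set.Ioc_subset_Ioc_right hγ1.le).trans s1
  have s3 : Set.Ioc γ 1 ⊆ Set.Ioc (a k) (b k) :=
    (Set.Ioc_subset_Ioc_left hγ0.le).trans s1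
  have vR : (volume R).toReal = W ∅ := by
    have := hR _ s1
    rw [eR] at this
    simpa using this
  have vRl : (volume Rl).toReal = γ * W ∅ := by
    have := hR _ s2
    rw [eRl] at this
    simpa [hγ0.le] using this
  have vRr : (volume Rr).toReal = (1 - γ) * W ∅ := by
    have := hR _ s3
    rw [eRr] at this
    simpa [hγ1.le] using this
  have hWpos : 0 < W ∅ := by
    rw [hW]
    unfold Wfac
    apply Finset.prod_pos
    intro l _
    have := (hab l).2.1
    simp [this, this.le]
  have hWe : W ((S j).erase k) = W (S j) := by
    simp only [hW, Wfac]
    apply Finset.prod_congr rfl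
    intro l hl
    simp [Finset.ne_of_mem_erase hl]
  have hq : q = W (S j) / W ∅ := by
    have := hv ((S j).erase k) _ s1
    change (volume ((R ∩ _) ∩ _)).toReal = _ at this
    rw [eR] at this
    simp only [q]
    rw [this, vR, ← hW, hWe]
    simp
  have hfin : volume R ≠ ⊤ := by
    intro h
    rw [h] at vR
    simp at vR
    linarith
  have hmean : ∀ s, s ⊆ Set.Ioc (a k) (b k) → 0 < (volume s).toReal →
      ((volume (R ∩ {x | x k ∈ s})).toReal)⁻¹ * ∫ x in R ∩ {x | x k ∈ s}, f x
      = β0 + (∑ j' ∈ Finset.univ.erase j, β j' * W (S j') / W ∅)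
        + β j * q * ((volume (s ∩ Set.Iic (γthr k))).toReal / (volume s).toReal) := by
    intro s hs hpos
    have hint := int_slab S γthr β0 β (R ∩ {x | x k ∈ s})
      (measure_ne_top_of_subset Set.inter_subset_left hfin)
    change ∫ x in R ∩ {x | x k ∈ s}, f x = _ at hint
    rw [hint, ← Finset.sum_erase_add _ _ (Finset.mem_univ j), hR s hs, hv _ _ hs, if_pos hk, hq]
    have : ∑ j' ∈ Finset.univ.erase j, β j' *
        (volume ((R ∩ {x | x k ∈ s}) ∩ {x : Fin p → ℝ | ∀ l ∈ S j', x l ≤ γthr l})).toReal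
        = ((volume s).toReal * W ∅) * ∑ j' ∈ Finset.univ.erase j, β j' * W (S j') / W ∅ := by
      rw [Finset.mul_sum]
      apply Finset.sum_congr rfl
      intro i hi
      have hki : k ∉ S i := fun h =>
        Finset.disjoint_left.1 (hdisj i j (Finset.ne_of_mem_erase hi)) h hk
      rw [hv _ _ hs, if_neg hki, Set.inter_univ, ← hW]
      field_simp
    rw [this, ← hW]
    field_simp
    ring
  have hl := hmean _ s2 (by simpa [hγ0.le] using hγ0)
  have hr := hmean _ s3 (by simpa [hγ1.le] using hγ1)
  rw [eRl] at hl
  rw [eRr] at hr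
  have hml : ml = _ := hl
  have hmr : mr = _ := hr
  rw [hml, hmr, vR, vRl, vRr]
  have h1g : (1 - γ) ≠ 0 := by linarith
  have hγn : γ ≠ 0 := hγ0.ne'
  rw [Set.Ioc_inter_Iic, Set.Ioc_inter_Iic]
  simp only [Real.volume_Ioc]
  rw [ENNReal.toReal_ofReal (by linarith : (0:ℝ) ≤ γ - 0),
    ENNReal.toReal_ofReal (by linarith : (0:ℝ) ≤ 1 - γ), inf_eq_right.2 hg1.le]
  split_ifs with h
  · rw [inf_eq_left.2 h, ENNReal.toReal_ofReal (by linarith : (0:ℝ) ≤ γ - 0),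
      ENNReal.toReal_ofReal (by linarith : (0:ℝ) ≤ γthr k - γ)]
    simp only [sub_zero]
    field_simp
    ring
  · push Not at h
    rw [inf_eq_right.2 h.le, ENNReal.toReal_ofReal (by linarith : (0:ℝ) ≤ γthr k - 0),
      ENNReal.ofReal_of_nonpos (by linarith : γthr k - γ ≤ 0)]
    simp only [sub_zero, ENNReal.toReal_zero]
    field_simp
    ring
end

section
/- Under the setup of the impurity decrease formula for a signal split, assume additionally: C_β > 0, C_γ ∈ (0,1/2), |β_j| ≥ C_β, γ_ℓ ∈ [C_γ, 1−C_γ] for every ℓ ∈ S_j, a_ℓ = 0 for every ℓ ∈ S_j, and λ(R) ≥ ε for some ε > 0. Then splitting on coordinate k at the true threshold γ = γ_k yields Δ_I( R ∩ {x_k ≤ γ_k}, R ∩ {x_k > γ_k} ) ≥ (ε/2)·C_β²·C_γ^{2|S_j|−1}. -/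
open MeasureTheory

noncomputable def boxM (a b g : ℝ) : ℝ := max (min b g - a) 0 / (b - a)

lemma boxM_int (a b g : ℝ) :
    ∫ x in Set.Ioc a b, (if x ≤ g then (1 : ℝ) else 0) = max (min b g - a) 0 := by
  have h : (fun x : ℝ => if x ≤ g then (1 : ℝ) else 0) = (Set.Iic g).indicator 1 := by
    funext x
    simp [Set.indicator_apply]
  rw [h, integral_indicator_one measurableSet_Iic, measureReal_restrict_apply measurableSet_Iic,
    Set.inter_comm, Set.Ioc_inter_Iic]
  exact Real.volume_real_Ioc

lemma box_vol {p : ℕ} (a b : Fin p → ℝ) (hab : ∀ l, a l < b l) :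
    (volume (Set.univ.pi fun l => Set.Ioc (a l) (b l))).toReal = ∏ l, (b l - a l) := by
  rw [Real.volume_pi_Ioc_toReal (fun l => (hab l).le)]

lemma prod_ext {p : ℕ} (S : Finset (Fin p)) (u : Fin p → ℝ) :
    ∏ l ∈ S, u l = ∏ l, (if l ∈ S then u l else 1) := by
  simp

lemma box_int {p : ℕ} (a b g : Fin p → ℝ) (hab : ∀ l, a l < b l) (S : Finset (Fin p)) :
    ∫ x in (Set.univ.pi fun l => Set.Ioc (a l) (b l)),
      ∏ l ∈ S, (if x l ≤ g l then (1 : ℝ) else 0)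
    = (∏ l, (b l - a l)) * ∏ l ∈ S, boxM (a l) (b l) (g l) := by
  have h1 : ∀ x : Fin p → ℝ, ∏ l ∈ S, (if x l ≤ g l then (1 : ℝ) else 0)
      = ∏ l, (fun (l : Fin p) (t : ℝ) => if l ∈ S then (if t ≤ g l then (1 : ℝ) else 0) else 1) l (x l) :=
    fun x => prod_ext S _
  simp_rw [h1]
  rw [volume_pi, Measure.restrict_pi_pi]
  refine (integral_fintype_prod_eq_prod (μ := fun i => volume.restrict (Set.Ioc (a i) (b i)))
    (fun (l : Fin p) (t : ℝ) =>
      if l ∈ S then (if t ≤ g l then (1 : ℝ) else 0) else 1)).trans ?_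
  rw [prod_ext S, ← Finset.prod_mul_distrib]
  refine Finset.prod_congr rfl fun l _ => ?_
  have := sub_pos.2 (hab l)
  by_cases hl : l ∈ S
  · simp only [hl, if_true]
    rw [boxM_int, boxM]
    field_simp
  · simp [hl, this.le]

lemma box_integrable {p : ℕ} (a b g : Fin p → ℝ) (S : Finset (Fin p)) :
    IntegrableOn (fun x : Fin p → ℝ => ∏ l ∈ S, (if x l ≤ g l then (1 : ℝ) else 0))
      (Set.univ.pi fun l => Set.Ioc (a l) (b l)) := by
  have hm : Measurable (fun x : Fin p → ℝ => ∏ l ∈ S, (if x l ≤ g l then (1 : ℝ) else 0)) := by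
    refine Finset.measurable_prod _ fun l _ => ?_
    exact Measurable.ite (measurableSet_le (measurable_pi_apply l) measurable_const)
      measurable_const measurable_const
  refine Measure.integrableOn_of_bounded (M := 1) ?_ hm.aestronglyMeasurable ?_
  · rw [Real.volume_pi_Ioc]
    exact ENNReal.prod_ne_top fun l _ => ENNReal.ofReal_ne_top
  · refine Filter.Eventually.of_forall fun x => ?_
    rw [Real.norm_eq_abs, Finset.abs_prod]
    refine Finset.prod_le_one (fun _ _ => abs_nonneg _) fun l _ => ?_
    split_ifs <;> simp

lemma box_mean {p J : ℕ} (a b g : Fin p → ℝ) (hab : ∀ l, a l < b l)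
    (S : Fin J → Finset (Fin p)) (β0 : ℝ) (β : Fin J → ℝ) :
    ((volume (Set.univ.pi fun l => Set.Ioc (a l) (b l))).toReal)⁻¹ *
      ∫ x in (Set.univ.pi fun l => Set.Ioc (a l) (b l)),
        (β0 + ∑ j', β j' * ∏ l ∈ S j', (if x l ≤ g l then (1 : ℝ) else 0))
    = β0 + ∑ j', β j' * ∏ l ∈ S j', boxM (a l) (b l) (g l) := by
  have hi : ∀ j', IntegrableOn (fun x : Fin p → ℝ => β j' * ∏ l ∈ S j', (if x l ≤ g l then (1 : ℝ) else 0))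
      (Set.univ.pi fun l => Set.Ioc (a l) (b l)) := fun j' =>
    (box_integrable a b g (S j')).const_mul _
  have hfin : volume (Set.univ.pi fun l => Set.Ioc (a l) (b l)) ≠ ⊤ := by
    rw [Real.volume_pi_Ioc]
    exact ENNReal.prod_ne_top fun l _ => ENNReal.ofReal_ne_top
  have hc : Integrable (fun _ : Fin p → ℝ => β0)
      (volume.restrict (Set.univ.pi fun l => Set.Ioc (a l) (b l))) := integrableOn_const hfin
  rw [integral_add hc (integrable_finsetSum _ fun j' _ => hi j'),
    integral_finsetSum _ fun j' _ => hi j', setIntegral_const]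
  simp_rw [integral_const_mul, box_int a b g hab]
  rw [Measure.real, box_vol a b hab]
  have hpos : (0 : ℝ) < ∏ l, (b l - a l) := Finset.prod_pos fun l _ => sub_pos.2 (hab l)
  rw [smul_eq_mul, mul_add, inv_mul_cancel_left₀ hpos.ne', Finset.mul_sum]
  congr 1
  refine Finset.sum_congr rfl fun j' _ => ?_
  field_simp

/-- **Population core of Lemma 5 (lower bound on the impurity decrease of desirable
features).** Under the LSS model with `|β_j| ≥ C_β`, thresholds in `[C_γ, 1−C_γ]`,
vanishing lower constraints on the interaction coordinates, and `λ(R) ≥ ε`,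
splitting the box `R` on the signal coordinate `k ∈ S_j` at the true threshold `γ_k`
yields a population impurity decrease of at least `(ε/2)·C_β²·C_γ^{2|S_j|−1}`. -/
theorem desirable_feature_impurity_lower_bound (p J : ℕ) (hp : 1 ≤ p)
    (S : Fin J → Finset (Fin p)) (hSne : ∀ j, (S j).Nonempty)
    (hdisj : ∀ j₁ j₂, j₁ ≠ j₂ → Disjoint (S j₁) (S j₂))
    (C_β C_γ ε : ℝ) (hCβ : 0 < C_β) (hCγ : C_γ ∈ Set.Ioo (0 : ℝ) (1 / 2)) (hε : 0 < ε)
    (γthr : Fin p → ℝ) (hγthr : ∀ j, ∀ ℓ ∈ S j, γthr ℓ ∈ Set.Icc C_γ (1 - C_γ))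
    (β0 : ℝ) (β : Fin J → ℝ)
    (a b : Fin p → ℝ) (hab : ∀ ℓ, 0 ≤ a ℓ ∧ a ℓ < b ℓ ∧ b ℓ ≤ 1)
    (j : Fin J) (hβj : C_β ≤ |β j|)
    (k : Fin p) (hk : k ∈ S j) (hak : a k = 0) (hbk : b k = 1)
    (haSj : ∀ ℓ ∈ S j, a ℓ = 0)
    (hRε : ε ≤ (volume (Set.univ.pi fun ℓ => Set.Ioc (a ℓ) (b ℓ))).toReal) :
    let f : (Fin p → ℝ) → ℝ := fun x =>
      β0 + ∑ j', β j' * ∏ ℓ ∈ S j', (if x ℓ ≤ γthr ℓ then (1 : ℝ) else 0)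
    let R : Set (Fin p → ℝ) := Set.univ.pi fun ℓ => Set.Ioc (a ℓ) (b ℓ)
    let Rl : Set (Fin p → ℝ) := R ∩ {x | x k ≤ γthr k}
    let Rr : Set (Fin p → ℝ) := R ∩ {x | γthr k < x k}
    let ml : ℝ := ((volume Rl).toReal)⁻¹ * ∫ x in Rl, f x
    let mr : ℝ := ((volume Rr).toReal)⁻¹ * ∫ x in Rr, f x
    (ε / 2) * C_β ^ 2 * C_γ ^ (2 * (S j).card - 1)
      ≤ ((volume Rl).toReal * (volume Rr).toReal / (volume R).toReal) * (ml - mr) ^ 2 := by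
  intro f R Rl Rr ml mr
  obtain ⟨hC0, hC1⟩ := hCγ
  have hgk := hγthr j k hk
  obtain ⟨hg1, hg2⟩ := hgk
  have hlt : ∀ l, a l < b l := fun l => (hab l).2.1
  have hl : ∀ l, a l < Function.update b k (γthr k) l := by
    intro l
    by_cases h : l = k
    · subst h; simp [hak]; linarith
    · simp [h, hlt l]
  have hr : ∀ l, Function.update a k (γthr k) l < b l := by
    intro l
    by_cases h : l = k
    · subst h; simp [hbk]; linarith
    · simp [h, hlt l]
  have hRl : Rl = Set.univ.pi fun l => Set.Ioc (a l) (Function.update b k (γthr k) l) := by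
    ext x
    simp only [Rl, R, Set.mem_inter_iff, Set.mem_pi, Set.mem_univ, true_imp_iff, Set.mem_Ioc,
      Set.mem_setOf_eq]
    constructor
    · rintro ⟨h1, h2⟩ l
      by_cases h : l = k
      · subst h; simpa using ⟨(h1 l).1, h2⟩
      · simpa [h] using h1 l
    · intro h1
      have hk1 := h1 k
      simp only [Function.update_self] at hk1
      refine ⟨fun l => ?_, hk1.2⟩
      by_cases h : l = k
      · subst h; exact ⟨hk1.1, by linarith [hk1.2]⟩
      · simpa [h] using h1 l
  have hRr : Rr = Set.univ.pi fun l => Set.Ioc (Function.update a k (γthr k) l) (b l) := by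
    ext x
    simp only [Rr, R, Set.mem_inter_iff, Set.mem_pi, Set.mem_univ, true_imp_iff, Set.mem_Ioc,
      Set.mem_setOf_eq]
    constructor
    · rintro ⟨h1, h2⟩ l
      by_cases h : l = k
      · subst h; simpa using ⟨h2, (h1 l).2⟩
      · simpa [h] using h1 l
    · intro h1
      have hk1 := h1 k
      simp only [Function.update_self] at hk1
      refine ⟨fun l => ?_, hk1.1⟩
      by_cases h : l = k
      · subst h; exact ⟨by linarith [hk1.1], hk1.2⟩
      · simpa [h] using h1 l
  have hml : ml = β0 + ∑ j', β j' * ∏ l ∈ S j',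
      boxM (a l) (Function.update b k (γthr k) l) (γthr l) := by
    simp only [ml, f, hRl]
    exact box_mean _ _ _ hl S β0 β
  have hmr : mr = β0 + ∑ j', β j' * ∏ l ∈ S j',
      boxM (Function.update a k (γthr k) l) (b l) (γthr l) := by
    simp only [mr, f, hRr]
    exact box_mean _ _ _ hr S β0 β
  set q : ℝ := ∏ l ∈ (S j).erase k, boxM (a l) (b l) (γthr l) with hq
  have hdiff : ml - mr = β j * q := by
    rw [hml, hmr, add_sub_add_left_eq_sub, ← Finset.sum_sub_distrib, Finset.sum_eq_single j]
    · rw [← Finset.mul_prod_erase _ _ hk, ← Finset.mul_prod_erase (S j) (fun l =>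
        boxM (Function.update a k (γthr k) l) (b l) (γthr l)) hk]
      have e1 : boxM (a k) (Function.update b k (γthr k) k) (γthr k) = 1 := by
        have : 0 < γthr k := by linarith
        simp [boxM, hak, this.le, this.ne']
      have e2 : boxM (Function.update a k (γthr k) k) (b k) (γthr k) = 0 := by
        simp [boxM]
      have e3 : ∏ l ∈ (S j).erase k, boxM (a l) (Function.update b k (γthr k) l) (γthr l) = q :=
        Finset.prod_congr rfl fun l h => by
          rw [Function.update_of_ne (Finset.ne_of_mem_erase h)]
      rw [e1, e2, e3]; ring
    · intro j' _ hj'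
      rw [sub_eq_zero]
      congr 1
      refine Finset.prod_congr rfl fun l h => ?_
      have hne : l ≠ k := by
        rintro rfl
        exact Finset.disjoint_left.1 (hdisj _ _ hj') h hk
      simp [hne]
    · simp
  have hvol : ∀ (c d : Fin p → ℝ), ∏ l, (d l - c l)
      = (d k - c k) * ∏ l ∈ Finset.univ.erase k, (d l - c l) := fun c d =>
    (Finset.mul_prod_erase _ _ (Finset.mem_univ k)).symm
  have vR : (volume R).toReal = ∏ l ∈ Finset.univ.erase k, (b l - a l) := by
    rw [box_vol a b hlt, hvol, hak, hbk]; ring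
  have vRl : (volume Rl).toReal = γthr k * (volume R).toReal := by
    rw [vR, hRl, box_vol _ _ hl, hvol, hak]
    simp only [Function.update_self, sub_zero]
    congr 1
    exact Finset.prod_congr rfl fun l h => by
      rw [Function.update_of_ne (Finset.ne_of_mem_erase h)]
  have vRr : (volume Rr).toReal = (1 - γthr k) * (volume R).toReal := by
    rw [vR, hRr, box_vol _ _ hr, hvol, hbk]
    simp only [Function.update_self]
    congr 1
    exact Finset.prod_congr rfl fun l h => by
      rw [Function.update_of_ne (Finset.ne_of_mem_erase h)]
  have hV : ε ≤ (volume R).toReal := hRε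
  have hqC : C_γ ^ ((S j).card - 1) ≤ q := by
    rw [← Finset.card_erase_of_mem hk, ← Finset.prod_const]
    refine Finset.prod_le_prod (fun _ _ => hC0.le) fun l h => ?_
    have hlS := Finset.mem_of_mem_erase h
    have h0 := haSj l hlS
    have h1 := (hγthr j l hlS).1
    have h2 := hlt l
    have h3 := (hab l).2.2
    rw [h0] at h2
    rw [boxM, h0, sub_zero, sub_zero, le_div_iff₀ h2]
    refine le_trans (le_min ?_ ?_) (le_max_left _ _) <;> nlinarith
  rw [vRl, vRr, hdiff]
  generalize (volume R).toReal = V at hV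
  have hVp : 0 < V := by linarith
  have hs : 2 * (S j).card - 1 = 1 + 2 * ((S j).card - 1) := by
    have := (hSne j).card_pos
    omega
  have hlhs : γthr k * V * ((1 - γthr k) * V) / V * (β j * q) ^ 2
      = V * (γthr k * (1 - γthr k)) * (β j) ^ 2 * q ^ 2 := by
    field_simp
  rw [hlhs, hs, pow_add, pow_one, mul_comm 2 ((S j).card - 1), pow_mul]
  have hβ2 : C_β ^ 2 ≤ (β j) ^ 2 := by
    rw [← sq_abs (β j)]
    exact pow_le_pow_left₀ hCβ.le hβj 2
  have hg : C_γ / 2 ≤ γthr k * (1 - γthr k) := by nlinarith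
  calc ε / 2 * C_β ^ 2 * (C_γ * (C_γ ^ ((S j).card - 1)) ^ 2)
      = ε * (C_γ / 2) * C_β ^ 2 * (C_γ ^ ((S j).card - 1)) ^ 2 := by ring
    _ ≤ V * (γthr k * (1 - γthr k)) * (β j) ^ 2 * q ^ 2 := by
      have : 0 ≤ γthr k * (1 - γthr k) := by linarith
      gcongr
end

section
/- Let γ_k ∈ (0,1) and γ ∈ (0,1), and define the ratio r(γ) = 1(γ ≤ γ_k)·((1−γ_k)·γ)/(γ_k·(1−γ)) + 1(γ > γ_k)·(γ_k·(1−γ))/((1−γ_k)·γ). Then 1 − r(γ) ≥ |γ_k − γ|. -/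
/-- **Key inequality in the proof of Lemma 6 (threshold consistency).**
For `γ_k, γ ∈ (0,1)`, the impurity-decrease ratio
`r(γ) = 1(γ ≤ γ_k)·(1−γ_k)γ/(γ_k(1−γ)) + 1(γ > γ_k)·γ_k(1−γ)/((1−γ_k)γ)`
satisfies `1 − r(γ) ≥ |γ_k − γ|`. -/
theorem one_sub_ratio_ge_abs (γk γ : ℝ)
    (hγk : γk ∈ Set.Ioo (0 : ℝ) 1) (hγ : γ ∈ Set.Ioo (0 : ℝ) 1) :
    |γk - γ| ≤ 1 - (if γ ≤ γk then ((1 - γk) * γ) / (γk * (1 - γ))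
                    else (γk * (1 - γ)) / ((1 - γk) * γ)) := by
  obtain ⟨ha, ha'⟩ := hγk
  obtain ⟨hb, hb'⟩ := hγ
  have h1 : 0 < 1 - γk := by linarith
  have h2 : 0 < 1 - γ := by linarith
  split_ifs with h
  · have hd : 0 < γk * (1 - γ) := mul_pos ha h2
    have hd1 : γk * (1 - γ) ≤ 1 := by nlinarith
    have e : 1 - ((1 - γk) * γ) / (γk * (1 - γ)) = (γk - γ) / (γk * (1 - γ)) := by
      rw [eq_div_iff hd.ne', sub_mul, div_mul_cancel₀ _ hd.ne']
      ring
    rw [abs_of_nonneg (by linarith), e, le_div_iff₀ hd]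
    exact mul_le_of_le_one_right (by linarith) hd1
  · have hd : 0 < (1 - γk) * γ := mul_pos h1 hb
    have hd1 : (1 - γk) * γ ≤ 1 := by nlinarith
    have e : 1 - (γk * (1 - γ)) / ((1 - γk) * γ) = (γ - γk) / ((1 - γk) * γ) := by
      rw [eq_div_iff hd.ne', sub_mul, div_mul_cancel₀ _ hd.ne']
      ring
    rw [abs_sub_comm, abs_of_nonneg (by linarith), e, le_div_iff₀ hd]
    exact mul_le_of_le_one_right (by linarith) hd1
end

section
/- Let γ_k ∈ (0,1) and define h(γ) = 1(γ ≤ γ_k)·(1−γ_k)²·γ/(1−γ) + 1(γ > γ_k)·γ_k²·(1−γ)/γ for γ ∈ (0,1). Then h(γ) ≤ γ_k·(1−γ_k) for all γ ∈ (0,1), with equality if and only if γ = γ_k. -/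
/-- **The threshold factor of the impurity decrease is uniquely maximized at the true
threshold.** For `γ_k ∈ (0,1)`, the function
`h(γ) = 1(γ ≤ γ_k)·(1−γ_k)²γ/(1−γ) + 1(γ > γ_k)·γ_k²(1−γ)/γ` satisfies
`h(γ) ≤ γ_k(1−γ_k)` on `(0,1)`, with equality iff `γ = γ_k`. -/
theorem threshold_factor_max (γk : ℝ) (hγk : γk ∈ Set.Ioo (0 : ℝ) 1)
    (γ : ℝ) (hγ : γ ∈ Set.Ioo (0 : ℝ) 1) :
    (if γ ≤ γk then (1 - γk) ^ 2 * γ / (1 - γ) else γk ^ 2 * (1 - γ) / γ)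
        ≤ γk * (1 - γk)
    ∧ ((if γ ≤ γk then (1 - γk) ^ 2 * γ / (1 - γ) else γk ^ 2 * (1 - γ) / γ)
          = γk * (1 - γk) ↔ γ = γk) := by
  obtain ⟨h0, h1⟩ := hγk
  obtain ⟨g0, g1⟩ := hγ
  have h1' : 0 < 1 - γk := by linarith
  have g1' : 0 < 1 - γ := by linarith
  split_ifs with h
  · have key : γk * (1 - γk) * (1 - γ) - (1 - γk) ^ 2 * γ = (1 - γk) * (γk - γ) := by ring
    refine ⟨?_, ?_⟩
    · rw [div_le_iff₀ g1']
      have := mul_nonneg h1'.le (sub_nonneg.2 h)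
      linarith
    · rw [div_eq_iff g1'.ne']
      constructor
      · intro e
        have h2 : (1 - γk) * (γk - γ) = 0 := by linarith
        rcases mul_eq_zero.1 h2 with h3 | h3 <;> linarith
      · rintro rfl
        ring
  · push Not at h
    have key : γk * (1 - γk) * γ - γk ^ 2 * (1 - γ) = γk * (γ - γk) := by ring
    have hp := mul_pos h0 (sub_pos.2 h)
    refine ⟨?_, ?_⟩
    · rw [div_le_iff₀ g0]
      linarith
    · rw [div_eq_iff g0.ne']
      constructor
      · intro e
        linarith
      · intro e
        linarith
end

section
/- Let p, m, s be integers with 1 ≤ s ≤ p and 1 ≤ m ≤ p, and let C_m ∈ (0,1) be a real number such that C_m·p ≤ m and m ≤ (1−C_m)·(p−s+1) + 1. Then, as real numbers, C(p−s, m−1) ≥ C_m^s · C(p, m), where C(·,·) denotes the binomial coefficient. -/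
/-- **Combinatorial core of Theorem 6 (balanced root feature selection).**
If `C_m·p ≤ m` and `m ≤ (1−C_m)·(p−s+1) + 1` with `C_m ∈ (0,1)`, then
`C(p−s, m−1) ≥ C_m^s · C(p, m)`. -/
theorem choose_lower_bound_root_selection (p m s : ℕ)
    (hs : 1 ≤ s) (hsp : s ≤ p) (hm : 1 ≤ m) (hmp : m ≤ p)
    (Cm : ℝ) (hCm : Cm ∈ Set.Ioo (0 : ℝ) 1)
    (h1 : Cm * (p : ℝ) ≤ (m : ℝ))
    (h2 : (m : ℝ) ≤ (1 - Cm) * ((p : ℝ) - (s : ℝ) + 1) + 1) :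
    Cm ^ s * (Nat.choose p m : ℝ) ≤ (Nat.choose (p - s) (m - 1) : ℝ) := by
  obtain ⟨hC0, hC1⟩ := hCm
  obtain ⟨r, rfl⟩ : ∃ r, m = r + 1 := ⟨m - 1, by omega⟩
  simp only [Nat.add_sub_cancel]
  have key : ∀ k : ℕ, k + 1 ≤ s →
      Cm ^ (k + 1) * (Nat.choose p (r + 1) : ℝ) ≤ (Nat.choose (p - (k + 1)) r : ℝ) := by
    intro k
    induction k with
    | zero =>
      intro _
      obtain ⟨q, rfl⟩ : ∃ q, p = q + 1 := ⟨p - 1, by omega⟩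
      have h := Nat.add_one_mul_choose_eq q r
      have h' : ((q : ℝ) + 1) * (q.choose r : ℝ) = ((q + 1).choose (r + 1) : ℝ) * ((r : ℝ) + 1) := by
        exact_mod_cast h
      push_cast at h1
      have hq : (0 : ℝ) < (q : ℝ) + 1 := by positivity
      have h3 := mul_le_mul_of_nonneg_right h1 (Nat.cast_nonneg (α := ℝ) ((q + 1).choose (r + 1)))
      simp only [zero_add, pow_one, Nat.add_sub_cancel]
      refine le_of_mul_le_mul_left ?_ hq
      linarith
    | succ k ih =>
      intro hk
      have ih := ih (by omega)
      obtain ⟨n, hn⟩ : ∃ n, p = n + (k + 1 + 1) := ⟨p - (k + 1 + 1), by omega⟩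
      have e1 : p - (k + 1) = n + 1 := by omega
      have e2 : p - (k + 1 + 1) = n := by omega
      rw [e1] at ih
      rw [e2]
      have hps : (p : ℝ) - s + 1 ≤ (n : ℝ) + 1 := by
        have : p ≤ n + s := by omega
        have : (p : ℝ) ≤ n + s := by exact_mod_cast this
        linarith
      have hn0 : (0 : ℝ) < (n : ℝ) + 1 := by positivity
      push_cast at h2
      have h4 := mul_le_mul_of_nonneg_left hps (by linarith : (0 : ℝ) ≤ 1 - Cm)
      have h5 : Cm * ((n : ℝ) + 1) ≤ (n : ℝ) + 1 - r := by linarith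
      have h6 : r ≤ n + 1 := by
        have : (r : ℝ) ≤ n + 1 := by
          have := mul_pos hC0 hn0
          linarith
        exact_mod_cast this
      have h := Nat.choose_mul_succ_eq n r
      have h' : (n.choose r : ℝ) * ((n : ℝ) + 1) = ((n + 1).choose r : ℝ) * ((n : ℝ) + 1 - r) := by
        have := congrArg (Nat.cast (R := ℝ)) h
        push_cast [Nat.cast_sub h6] at this
        exact this
      have h7 := mul_le_mul_of_nonneg_left h5 (Nat.cast_nonneg (α := ℝ) ((n + 1).choose r))
      have h8 : Cm * ((n + 1).choose r : ℝ) ≤ (n.choose r : ℝ) := by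
        refine le_of_mul_le_mul_right ?_ hn0
        linarith
      calc Cm ^ (k + 1 + 1) * (p.choose (r + 1) : ℝ)
          = Cm * (Cm ^ (k + 1) * (p.choose (r + 1) : ℝ)) := by ring
        _ ≤ Cm * ((n + 1).choose r : ℝ) := mul_le_mul_of_nonneg_left ih hC0.le
        _ ≤ _ := h8
  have := key (s - 1) (by omega)
  rwa [Nat.sub_add_cancel hs] at this
end

section
/- Fix p ≥ 1 and sets S_1,…,S_J ⊆ {1,…,p}. A signed feature is a pair (k,b) ∈ {1,…,p}×{−1,+1}; for a set S ⊆ {1,…,p} write S^− = {(k,−1) : k ∈ S} and S^+ = {(k,+1) : k ∈ S}. Let P = ((k_1,b_1),…,(k_D,b_D)) be a finite sequence of signed features. For 0 ≤ t ≤ D let F_t denote the set of signed features (k_u,b_u) with u ≤ t such that u is the first index at which the feature k_u occurs in P, and define the desirable feature set U_t = {k ∈ {1,…,p} : there exists j with k ∈ S_j, S_j^+ ∩ F_t = ∅, and (k,−1) ∉ F_t}. Define 𝓕 = {(k_t, b_t) : 1 ≤ t ≤ D, t is the first index at which feature k_t occurs in P, and k_t ∈ U_{t−1}}. Then: if U_D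 = ∅, then for every j ∈ {1,…,J} either S_j^− ⊆ 𝓕 or S_j^+ ∩ 𝓕 ≠ ∅, and these two alternatives never hold simultaneously. -/
/-! **Lemma 1 of the paper**, stated as a purely combinatorial fact about a decision path.

A path of depth `D` is a sequence of signed features `(k t, b t)`, `t : Fin D`, where the
sign is encoded by a `Bool` (`false` = `−1`, i.e. the `≤` direction; `true` = `+1`,
i.e. the `>` direction). -/

namespace LSSPath

variable {p J D : ℕ}

/-- `t` is the first index at which the feature `k t` occurs on the path. -/
def FirstOcc (k : Fin D → Fin p) (t : Fin D) : Prop :=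
  ∀ u : Fin D, u < t → k u ≠ k t

/-- `F k b t`: the set of signed first appearances among the first `t` splits
(indices `u` with `(u : ℕ) < t`). -/
def F (k : Fin D → Fin p) (b : Fin D → Bool) (t : ℕ) : Set (Fin p × Bool) :=
  {fb | ∃ u : Fin D, (u : ℕ) < t ∧ FirstOcc k u ∧ fb = (k u, b u)}

/-- `U S k b t`: the desirable feature set after the first `t` splits: features belonging to
some basic interaction `S j` none of whose features has yet appeared with a `+` sign, and
which have not themselves yet appeared with a `−` sign. -/
def U (S : Fin J → Finset (Fin p)) (k : Fin D → Fin p) (b : Fin D → Bool) (t : ℕ) :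
    Set (Fin p) :=
  {x | ∃ j : Fin J, x ∈ S j ∧ (∀ y ∈ S j, ((y, true) : Fin p × Bool) ∉ F k b t) ∧
        ((x, false) : Fin p × Bool) ∉ F k b t}

/-- `𝓕`: the signed features of the path that were desirable at the moment of their first
appearance. -/
def desirableF (S : Fin J → Finset (Fin p)) (k : Fin D → Fin p) (b : Fin D → Bool) :
    Set (Fin p × Bool) :=
  {fb | ∃ t : Fin D, FirstOcc k t ∧ k t ∈ U S k b (t : ℕ) ∧ fb = (k t, b t)}

/-- **Lemma 1.** If the desirable features are exhausted at the leaf (`U` at time `D` is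
empty), then for every basic interaction `S j` either all of `S_j^−` appears in `𝓕`, or some
feature of `S_j^+` appears in `𝓕`; and these two alternatives never hold simultaneously. -/
theorem exhausted_desirable_features
    (S : Fin J → Finset (Fin p)) (k : Fin D → Fin p) (b : Fin D → Bool)
    (hU : U S k b D = ∅) :
    ∀ j : Fin J,
      ((∀ x ∈ S j, ((x, false) : Fin p × Bool) ∈ desirableF S k b)
          ∨ (∃ x ∈ S j, ((x, true) : Fin p × Bool) ∈ desirableF S k b))
      ∧ ¬((∀ x ∈ S j, ((x, false) : Fin p × Bool) ∈ desirableF S k b)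
          ∧ (∃ x ∈ S j, ((x, true) : Fin p × Bool) ∈ desirableF S k b)) := by
  intro j
  have key : ∀ t : Fin D, FirstOcc k t → k t ∈ S j →
      (∀ u : Fin D, u < t → FirstOcc k u → k u ∈ S j → b u = false) →
      (k t, b t) ∈ desirableF S k b := by
    intro t ht hk hb
    refine ⟨t, ht, ⟨j, hk, ?_, ?_⟩, rfl⟩
    · rintro y hy ⟨u, hu, hf, he⟩
      obtain ⟨rfl, h2⟩ := Prod.mk.inj he
      have := hb u hu hf hy
      rw [this] at h2
      exact Bool.noConfusion h2
    · rintro ⟨u, hu, hf, he⟩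
      exact ht u hu (Prod.mk.inj he).1.symm
  constructor
  · by_cases h : ∃ n : ℕ, ∃ t : Fin D, (t : ℕ) = n ∧ FirstOcc k t ∧ k t ∈ S j ∧ b t = true
    · right
      classical
      obtain ⟨t, htn, hf, hk, hb⟩ := Nat.find_spec h
      refine ⟨k t, hk, ?_⟩
      rw [← hb]
      refine key t hf hk ?_
      intro u hu hfu hku
      by_contra hbu
      have hlt : (u : ℕ) < Nat.find h := by
        rw [← htn]
        exact hu
      exact Nat.find_min h hlt ⟨u, rfl, hfu, hku, by simpa using hbu⟩
    · left
      intro x hx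
      have hall : ∀ u : Fin D, FirstOcc k u → k u ∈ S j → b u = false := by
        intro u hfu hku
        by_contra hbu
        exact h ⟨u, u, rfl, hfu, hku, by simpa using hbu⟩
      have hxF : ((x, false) : Fin p × Bool) ∈ F k b D := by
        by_contra hn
        have : x ∈ U S k b D := by
          refine ⟨j, hx, ?_, hn⟩
          rintro y hy ⟨u, hu, hf, he⟩
          obtain ⟨rfl, h2⟩ := Prod.mk.inj he
          rw [hall u hf hy] at h2
          exact Bool.noConfusion h2
        rw [hU] at this
        exact this
      obtain ⟨u, hu, hf, he⟩ := hxF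
      rw [he]
      obtain ⟨rfl, h2⟩ := Prod.mk.inj he
      exact key u hf hx (fun v _ hfv hkv => hall v hfv hkv)
  · rintro ⟨h1, x, hx, t, ht, -, he⟩
    obtain ⟨u, hu, -, he'⟩ := h1 x hx
    obtain ⟨e1, e2⟩ := Prod.mk.inj he
    obtain ⟨e3, e4⟩ := Prod.mk.inj he'
    have hk : k u = k t := e3.symm.trans e1
    rcases lt_trichotomy u t with h | h | h
    · exact ht u h hk
    · subst h
      rw [← e2] at e4
      exact Bool.noConfusion e4
    · exact hu t h hk.symm

end LSSPath
end
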